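/- arXiv:1703.08385 — 4 statements merged into one kernel-verified Lean document; each statement's English description precedes it below -/
import Mathlib

section
/- Let r ≥ 1, f : {1,…,d}^r → ℝ, and let U(x) = f(x₁,…,x_r) be a normalized potential depending only on the coordinates x₁,…,x_r. If the Borel probability measure α on Ω is quasi-C*-Gibbs for U, then there exists a constant c₂ > 0 such that for every s ≥ 1, every word (a₁,…,a_s) ∈ {1,…,d}^s and every x ∈ Ω with x_k = a_k for 1 ≤ k ≤ s, exp(−∑_{k=0}^{s−1} U(τ^k x)) · α({z ∈ Ω : z_k = a_k for 1 ≤ k ≤ s}) ≤ c₂. -/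
open MeasureTheory Filter
open scoped ENNReal

noncomputable section

/-- The two-sided full shift space `Ω = {1,…,d}^ℤ` (alphabet `Fin d`). -/
abbrev Omega (d : ℕ) : Type := ℤ → Fin d

/-- The shift map `τ`, `(τ x) j = x (j+1)`. -/
def tau (d : ℕ) (x : Omega d) : Omega d := fun j => x (j + 1)

/-- The `k`-th iterate of the shift (`k ∈ ℤ`): `(τ^k x) j = x (j + k)`. -/
def tauZ (d : ℕ) (k : ℤ) (x : Omega d) : Omega d := fun j => x (j + k)

/-- `x` and `y` are homoclinic: they differ in only finitely many coordinates. -/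
def Homoclinic (d : ℕ) (x y : Omega d) : Prop := Set.Finite {j : ℤ | x j ≠ y j}

/-- `U` is Hölder continuous for the standard metric `dist x y = 2^{-N}`:
there are `C > 0` and `0 < θ < 1` with `|U x - U y| ≤ C θ^N` whenever
`x` and `y` agree on all coordinates `|j| ≤ N`. -/
def HolderPotential (d : ℕ) (U : Omega d → ℝ) : Prop :=
  ∃ C θ : ℝ, 0 < C ∧ 0 < θ ∧ θ < 1 ∧
    ∀ (x y : Omega d) (N : ℕ), (∀ j : ℤ, |j| ≤ (N : ℤ) → x j = y j) →
      |U x - U y| ≤ C * θ ^ N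

/-- `U` depends on only finitely many coordinates. -/
def FiniteRange (d : ℕ) (U : Omega d → ℝ) : Prop :=
  ∃ s : Finset ℤ, ∀ x y : Omega d, (∀ j ∈ s, x j = y j) → U x = U y

/-- `V(x,y) = ∑_{k ∈ ℤ} (U(τ^k x) - U(τ^k y))`. -/
def Vfun (d : ℕ) (U : Omega d → ℝ) (x y : Omega d) : ℝ :=
  ∑' k : ℤ, (U (tauZ d k x) - U (tauZ d k y))

/-- The cylinder `{z : z_j = a_j for -n ≤ j ≤ m}`. -/
def cyl (d : ℕ) (n m : ℕ) (a : ℤ → Fin d) : Set (Omega d) :=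
  {z | ∀ j : ℤ, -(n : ℤ) ≤ j → j ≤ (m : ℤ) → z j = a j}

/-- The conjugating homeomorphism with window `-n ≤ j ≤ m` and target word `b`:
it replaces the coordinates in the window by those of `b` and keeps the rest. -/
def conjMap (d : ℕ) (n m : ℕ) (b : ℤ → Fin d) (z : Omega d) : Omega d :=
  fun j => if -(n : ℤ) ≤ j ∧ j ≤ (m : ℤ) then b j else z j

/-- `α` is a C*-Gibbs measure for `U` (at inverse temperature `β = 1`):
for every symmetric conjugating homeomorphism `(O, φ)` and every continuous
`f : Ω → ℂ`, `∫_O e^{-V(z, φ z)} f(φ z) dα = ∫_{φ(O)} f dα`. -/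
def CStarGibbs (d : ℕ) (U : Omega d → ℝ) (α : Measure (Omega d)) : Prop :=
  ∀ n : ℕ, 1 ≤ n → ∀ (a b : ℤ → Fin d) (f : Omega d → ℂ), Continuous f →
    ∫ z in cyl d n n a,
        (Real.exp (-(Vfun d U z (conjMap d n n b z))) : ℂ) * f (conjMap d n n b z) ∂α
      = ∫ z in cyl d n n b, f z ∂α

/-- `α` is a quasi-C*-Gibbs measure for `U`: there are constants `d₁, d₂ > 0`
such that for every conjugating homeomorphism `(O, φ)` and every nonnegative
continuous `f : Ω → ℝ`,
`d₁ ∫_O e^{-V(z,φz)} f(φ z) dα ≤ ∫_{φ(O)} f dα ≤ d₂ ∫_O e^{-V(z,φz)} f(φ z) dα`. -/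
def QuasiCStarGibbs (d : ℕ) (U : Omega d → ℝ) (α : Measure (Omega d)) : Prop :=
  ∃ d₁ d₂ : ℝ, 0 < d₁ ∧ 0 < d₂ ∧
    ∀ (n m : ℕ), 1 ≤ n → 1 ≤ m → ∀ (a b : ℤ → Fin d) (f : Omega d → ℝ),
      Continuous f → (∀ z, 0 ≤ f z) →
      (d₁ * ∫ z in cyl d n m a,
          Real.exp (-(Vfun d U z (conjMap d n m b z))) * f (conjMap d n m b z) ∂α
        ≤ ∫ z in cyl d n m b, f z ∂α) ∧
      (∫ z in cyl d n m b, f z ∂α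
        ≤ d₂ * ∫ z in cyl d n m a,
            Real.exp (-(Vfun d U z (conjMap d n m b z))) * f (conjMap d n m b z) ∂α)

/-- The future cylinder `{z : z_k = a_k for 1 ≤ k ≤ s}`. -/
def futureCyl (d : ℕ) (s : ℕ) (a : ℕ → Fin d) : Set (Omega d) :=
  {z | ∀ k : ℕ, 1 ≤ k → k ≤ s → z (k : ℤ) = a k}

/-- The Birkhoff sum `∑_{k=0}^{s-1} U(τ^k x)`. -/
def birkhoff (d : ℕ) (U : Omega d → ℝ) (s : ℕ) (x : Omega d) : ℝ :=
  ∑ k ∈ Finset.range s, U (tauZ d (k : ℤ) x)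

/-- `ρ` is the equilibrium (Gibbs) probability for `U`: it is `τ`-invariant and
satisfies Bowen's inequalities. -/
def IsEquilibrium (d : ℕ) (U : Omega d → ℝ) (ρ : Measure (Omega d)) : Prop :=
  Measure.map (tau d) ρ = ρ ∧
  ∃ C₁ C₂ P : ℝ, 0 < C₁ ∧ 0 < C₂ ∧
    ∀ s : ℕ, 1 ≤ s → ∀ (a : ℕ → Fin d) (x : Omega d),
      (∀ k : ℕ, 1 ≤ k → k ≤ s → x (k : ℤ) = a k) →
      C₁ ≤ (ρ (futureCyl d s a)).toReal * Real.exp (P * s - birkhoff d U s x) ∧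
      (ρ (futureCyl d s a)).toReal * Real.exp (P * s - birkhoff d U s x) ≤ C₂

/-- The point whose coordinates `1, 2, 3, …` are `j, x₁, x₂, …`. -/
def prepend (d : ℕ) (j : Fin d) (x : Omega d) : Omega d :=
  fun k => if k = 1 then j else x (k - 1)

/-- A potential depending on the coordinates `x₁, …, x_r` is normalized if
`∑_{j=1}^d exp(f(j, x₁, …, x_{r-1})) = 1` for all choices of `x₁, …, x_{r-1}`. -/
def Normalized (d : ℕ) (U : Omega d → ℝ) : Prop :=
  ∀ x : Omega d, ∑ j : Fin d, Real.exp (U (prepend d j x)) = 1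

/-- The point whose coordinates `1, …, s, s + 1, …` are `w₀, …, w_{s-1}, y₁, y₂, …`. -/
def prependWord (d : ℕ) : (s : ℕ) → (Fin s → Fin d) → Omega d → Omega d
  | 0, _, y => y
  | s + 1, w, y => prepend d (w 0) (prependWord d s (Fin.tail w) y)

theorem prependWord_apply (d : ℕ) {s : ℕ} (w : Fin s → Fin d) (y : Omega d) (i : Fin s) :
    prependWord d s w y ((i : ℕ) + 1) = w i := by
  induction s with
  | zero => exact i.elim0
  | succ s ih =>
    refine Fin.cases ?_ (fun i => ?_) i
    · simp [prependWord, prepend]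
    · have h1 : ((i : ℕ) : ℤ) + 1 ≠ 0 := by omega
      simpa [prependWord, prepend, h1, Fin.tail] using ih (Fin.tail w) i

section LocalPotential

variable {d r : ℕ} {f : (Fin r → Fin d) → ℝ} {U : Omega d → ℝ}

theorem potential_congr (hUf : ∀ x : Omega d, U x = f (fun i => x (((i : ℕ) : ℤ) + 1)))
    {x y : Omega d} (hxy : ∀ j : ℤ, 1 ≤ j → j ≤ r → x j = y j) : U x = U y := by
  rw [hUf, hUf]
  congr 1
  funext i
  exact hxy _ (by omega) (by have := i.2; omega)

theorem birkhoff_succ_prepend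
    (hUf : ∀ x : Omega d, U x = f (fun i => x (((i : ℕ) : ℤ) + 1)))
    (s : ℕ) (j : Fin d) (x : Omega d) :
    birkhoff d U (s + 1) (prepend d j x) = birkhoff d U s x + U (prepend d j x) := by
  unfold birkhoff
  rw [Finset.sum_range_succ']
  congr 1
  · refine Finset.sum_congr rfl fun k _ => potential_congr hUf fun i hi _ => ?_
    have h1 : i + ((k : ℤ) + 1) ≠ 1 := by omega
    simp only [tauZ, prepend, Nat.cast_add, Nat.cast_one, h1, if_false]
    congr 1
    ring
  · exact congrArg U (funext fun i => by simp [tauZ])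

theorem sum_exp_birkhoff_prependWord
    (hUf : ∀ x : Omega d, U x = f (fun i => x (((i : ℕ) : ℤ) + 1)))
    (hnorm : Normalized d U) (s : ℕ) (y : Omega d) :
    ∑ w : Fin s → Fin d, Real.exp (birkhoff d U s (prependWord d s w y)) = 1 := by
  induction s with
  | zero => simp [birkhoff]
  | succ s ih =>
    rw [← (Fin.consEquiv fun _ : Fin (s + 1) => Fin d).sum_comp, Fintype.sum_prod_type,
      Finset.sum_comm, ← ih]
    refine Finset.sum_congr rfl fun w _ => ?_
    have hw : ∀ j : Fin d, prependWord d (s + 1)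
        ((Fin.consEquiv fun _ : Fin (s + 1) => Fin d) (j, w)) y
          = prepend d j (prependWord d s w y) := fun j => by
      simp [prependWord, Fin.consEquiv]
    simp_rw [hw, birkhoff_succ_prepend hUf, Real.exp_add]
    rw [← Finset.mul_sum, hnorm, mul_one]

theorem birkhoff_le_of_agree
    (hUf : ∀ x : Omega d, U x = f (fun i => x (((i : ℕ) : ℤ) + 1)))
    {M : ℝ} (hM : ∀ x, |U x| ≤ M) (hM0 : 0 ≤ M) {s : ℕ} {x y : Omega d}
    (hxy : ∀ j : ℤ, 1 ≤ j → j ≤ s → x j = y j) :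
    birkhoff d U s x ≤ birkhoff d U s y + 2 * M * r := by
  have key : ∀ k ∈ Finset.range s, U (tauZ d k x) - U (tauZ d k y)
      ≤ if k ∈ Finset.Ico (s - r) s then 2 * M else 0 := by
    intro k hk
    rw [Finset.mem_range] at hk
    split_ifs with h1
    · have h2 := abs_le.1 (hM (tauZ d k x))
      have h3 := abs_le.1 (hM (tauZ d k y))
      linarith [h2.2, h3.1]
    · rw [Finset.mem_Ico] at h1
      refine (sub_eq_zero.2 (potential_congr hUf fun j hj hj' => ?_)).le
      exact hxy _ (by omega) (by omega)
  have hsum := Finset.sum_le_sum key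
  rw [Finset.sum_sub_distrib, ← Finset.sum_filter, Finset.sum_const, nsmul_eq_mul] at hsum
  have hcard : (((Finset.range s).filter (· ∈ Finset.Ico (s - r) s)).card : ℝ) ≤ r := by
    have h1 : ((Finset.range s).filter (· ∈ Finset.Ico (s - r) s)) ⊆ Finset.Ico (s - r) s :=
      fun k hk => (Finset.mem_filter.1 hk).2
    have h2 := Finset.card_le_card h1
    rw [Nat.card_Ico] at h2
    exact_mod_cast (by omega : _ ≤ r)
  have := mul_le_mul_of_nonneg_right hcard (by linarith : 0 ≤ 2 * M)
  unfold birkhoff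
  linarith

theorem Vfun_conjMap (hUf : ∀ x : Omega d, U x = f (fun i => x (((i : ℕ) : ℤ) + 1)))
    (n m : ℕ) (b : ℤ → Fin d) (z : Omega d) :
    Vfun d U z (conjMap d n m b z) =
      ∑ k ∈ Finset.Ico (-(n + r : ℤ)) m,
        (U (tauZ d k z) - U (tauZ d k (conjMap d n m b z))) := by
  refine tsum_eq_sum fun k hk => sub_eq_zero.2 (potential_congr hUf fun j hj hj' => ?_)
  rw [Finset.mem_Ico] at hk
  have : ¬ (-(n : ℤ) ≤ j + k ∧ j + k ≤ m) := by omega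
  simp [tauZ, conjMap, this]

theorem Vfun_conjMap_le (hUf : ∀ x : Omega d, U x = f (fun i => x (((i : ℕ) : ℤ) + 1)))
    {M : ℝ} (hM : ∀ x, |U x| ≤ M) (n m : ℕ) (b : ℤ → Fin d) (z : Omega d) :
    Vfun d U z (conjMap d n m b z) ≤
      2 * M * (n + r) + (birkhoff d U m z - birkhoff d U m (conjMap d n m b z)) := by
  rw [Vfun_conjMap hUf, ← Finset.Ico_union_Ico_eq_Ico (by omega : -(n + r : ℤ) ≤ 0)
    (by omega : (0 : ℤ) ≤ m), Finset.sum_union (Finset.Ico_disjoint_Ico_consecutive _ _ _)]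
  refine add_le_add ?_ (le_of_eq ?_)
  · have hle := Finset.sum_le_card_nsmul (Finset.Ico (-(n + r : ℤ)) 0)
      (fun k => U (tauZ d k z) - U (tauZ d k (conjMap d n m b z))) (2 * M) (fun k _ => by
        have h2 := abs_le.1 (hM (tauZ d k z))
        have h3 := abs_le.1 (hM (tauZ d k (conjMap d n m b z)))
        linarith [h2.2, h3.1])
    refine hle.trans (le_of_eq ?_)
    have hc : (Finset.Ico (-(n + r : ℤ)) 0).card = n + r := by
      rw [Int.card_Ico]; omega
    rw [hc, nsmul_eq_mul]
    push_cast
    ring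
  · unfold birkhoff
    rw [← Finset.sum_sub_distrib]
    symm
    refine Finset.sum_bij (fun (k : ℕ) _ => (k : ℤ)) ?_ ?_ ?_ ?_
    · intro k hk
      simpa using hk
    · intro k _ l _ hkl
      exact_mod_cast hkl
    · intro k hk
      rw [Finset.mem_Ico] at hk
      exact ⟨k.toNat, by simp; omega, by simp [hk.1]⟩
    · intro k _
      rfl

theorem measurable_Vfun_conjMap
    (hUf : ∀ x : Omega d, U x = f (fun i => x (((i : ℕ) : ℤ) + 1)))
    (n m : ℕ) (b : ℤ → Fin d) :
    Measurable fun z => Vfun d U z (conjMap d n m b z) := by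
  have hU : Measurable U := by
    have : U = fun x => f (fun i => x (((i : ℕ) : ℤ) + 1)) := funext hUf
    rw [this]
    exact (measurable_of_countable f).comp (measurable_pi_lambda _ fun i => measurable_pi_apply _)
  have hτ : ∀ k, Measurable (tauZ d k) := fun k =>
    measurable_pi_lambda _ fun j => measurable_pi_apply _
  have hφ : Measurable (conjMap d n m b) := by
    refine measurable_pi_lambda _ fun j => ?_
    unfold conjMap
    split_ifs
    · exact measurable_const
    · exact measurable_pi_apply _
  simp_rw [Vfun_conjMap hUf]
  exact Finset.measurable_sum _ fun k _ =>
    (hU.comp (hτ k)).sub (hU.comp ((hτ k).comp hφ))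

theorem measurableSet_cyl (n m : ℕ) (a : ℤ → Fin d) : MeasurableSet (cyl d n m a) := by
  have : cyl d n m a = ⋂ j ∈ Set.Icc (-(n : ℤ)) m, (fun z : Omega d => z j) ⁻¹' {a j} := by
    ext z
    simp [cyl]
  rw [this]
  exact MeasurableSet.biInter (Set.to_countable _) fun j _ =>
    measurable_pi_apply j (measurableSet_singleton _)

theorem integrable_exp_neg_Vfun_conjMap
    (hUf : ∀ x : Omega d, U x = f (fun i => x (((i : ℕ) : ℤ) + 1)))
    {M : ℝ} (hM : ∀ x, |U x| ≤ M) (n m : ℕ) (b : ℤ → Fin d)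
    (μ : Measure (Omega d)) [IsFiniteMeasure μ] :
    Integrable (fun z => Real.exp (-(Vfun d U z (conjMap d n m b z)))) μ := by
  refine Integrable.of_bound
    (measurable_Vfun_conjMap hUf n m b).neg.exp.aestronglyMeasurable
    (Real.exp (∑ _k ∈ Finset.Ico (-(n + r : ℤ)) m, 2 * M)) (Eventually.of_forall fun z => ?_)
  rw [Real.norm_eq_abs, abs_of_pos (Real.exp_pos _), Real.exp_le_exp, Vfun_conjMap hUf,
    ← Finset.sum_neg_distrib]
  refine Finset.sum_le_sum fun k _ => ?_
  have h2 := abs_le.1 (hM (tauZ d k z))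
  have h3 := abs_le.1 (hM (tauZ d k (conjMap d n m b z)))
  linarith [h2.1, h3.2]

/-- Comparison of the masses of two cylinders over the same window. -/
theorem exp_mul_measureReal_cyl_le
    (hUf : ∀ x : Omega d, U x = f (fun i => x (((i : ℕ) : ℤ) + 1)))
    {M : ℝ} (hM : ∀ x, |U x| ≤ M) (hM0 : 0 ≤ M)
    {α : Measure (Omega d)} [IsFiniteMeasure α] {d₁ : ℝ} (hd₁ : 0 < d₁)
    {n m : ℕ} {a b : ℤ → Fin d}
    (h : d₁ * ∫ z in cyl d n m a, Real.exp (-(Vfun d U z (conjMap d n m b z))) ∂α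
      ≤ α.real (cyl d n m b))
    {x y : Omega d} (hx : ∀ j : ℤ, 1 ≤ j → j ≤ m → x j = a j)
    (hy : ∀ j : ℤ, 1 ≤ j → j ≤ m → y j = b j) :
    d₁ * (Real.exp (birkhoff d U m y - birkhoff d U m x - (2 * M * (n + r) + 4 * M * r)) *
      α.real (cyl d n m a)) ≤ α.real (cyl d n m b) := by
  refine le_trans (mul_le_mul_of_nonneg_left ?_ hd₁.le) h
  refine setIntegral_ge_of_const_le_real (measurableSet_cyl n m a) (measure_ne_top _ _)
    (fun z hz => ?_) (integrable_exp_neg_Vfun_conjMap hUf hM n m b _)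
  rw [Real.exp_le_exp]
  have h1 := Vfun_conjMap_le hUf hM n m b z
  have h2 : birkhoff d U m z ≤ birkhoff d U m x + 2 * M * r :=
    birkhoff_le_of_agree hUf hM hM0 fun j hj hj' => by
      rw [hx j hj hj']; exact hz j (by omega) hj'
  have h3 : birkhoff d U m y ≤ birkhoff d U m (conjMap d n m b z) + 2 * M * r :=
    birkhoff_le_of_agree hUf hM hM0 fun j hj hj' => by
      rw [hy j hj hj', conjMap, if_pos ⟨by omega, hj'⟩]
  linarith

end LocalPotential

/-- The word on `ℤ` that agrees with `y` except for the letters `p`, `q` at `-1`, `0`. -/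
def setLetters {d : ℕ} (p : Fin d × Fin d) (y : Omega d) : ℤ → Fin d :=
  fun j => if j = -1 then p.1 else if j = 0 then p.2 else y j

theorem setLetters_of_pos {d : ℕ} (p : Fin d × Fin d) (y : Omega d) {j : ℤ} (hj : 1 ≤ j) :
    setLetters p y j = y j := by
  rw [setLetters, if_neg (by omega), if_neg (by omega)]

theorem measureReal_futureCyl_le_sum {d s : ℕ} (α : Measure (Omega d)) [IsFiniteMeasure α]
    {a : ℕ → Fin d} {x : Omega d} (hx : ∀ k : ℕ, 1 ≤ k → k ≤ s → x (k : ℤ) = a k) :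
    α.real (futureCyl d s a) ≤ ∑ p : Fin d × Fin d, α.real (cyl d 1 s (setLetters p x)) := by
  refine le_trans (measureReal_mono (fun z hz => ?_) (measure_ne_top _ _))
    (measureReal_iUnion_fintype_le _)
  refine Set.mem_iUnion.2 ⟨(z (-1), z 0), fun j hj hj' => ?_⟩
  rcases (by push_cast at hj; omega : j = -1 ∨ j = 0 ∨ 1 ≤ j) with rfl | rfl | h1
  · simp [setLetters]
  · simp [setLetters]
  · rw [setLetters_of_pos _ _ h1]
    lift j to ℕ using by omega
    rw [hx j (by omega) (by omega), hz j (by omega) (by omega)]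

theorem sum_measureReal_cyl_prependWord_le_one {d : ℕ} (s : ℕ) (α : Measure (Omega d))
    [IsProbabilityMeasure α] (y : Omega d) :
    ∑ p : Fin d × Fin d, ∑ w : Fin s → Fin d,
      α.real (cyl d 1 s (setLetters p (prependWord d s w y))) ≤ 1 := by
  rw [← Fintype.sum_prod_type'
    (fun p w => α.real (cyl d 1 s (setLetters p (prependWord d s w y)))),
    ← measureReal_iUnion_fintype (fun pw qv hne => Set.disjoint_left.2 fun z hz hz' => hne ?_)
      fun _ => measurableSet_cyl _ _ _]
  · exact measureReal_le_one
  have key : ∀ j : ℤ, -1 ≤ j → j ≤ s → setLetters pw.1 (prependWord d s pw.2 y) j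
      = setLetters qv.1 (prependWord d s qv.2 y) j := fun j hj hj' =>
    (hz j (by simpa using hj) hj').symm.trans (hz' j (by simpa using hj) hj')
  refine Prod.ext (Prod.ext ?_ ?_) (funext fun i => ?_)
  · simpa [setLetters] using key (-1) (by omega) (by omega)
  · simpa [setLetters] using key 0 (by omega) (by omega)
  · have h1 := key ((i : ℕ) + 1) (by omega) (by have := i.2; omega)
    rwa [setLetters_of_pos _ _ (by omega), setLetters_of_pos _ _ (by omega),
      prependWord_apply, prependWord_apply] at h1

/-- for a normalized `U(x) = f(x₁,…,x_r)` and a quasi-C*-Gibbs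
`α`, there is `c₂ > 0` with
`exp(-∑_{k<s} U(τ^k x)) · α(cylinder) ≤ c₂` for every future cylinder. -/
theorem quasiGibbs_upper_bowen (d : ℕ) (hd : 2 ≤ d) (r : ℕ) (hr : 1 ≤ r)
    (f : (Fin r → Fin d) → ℝ) (U : Omega d → ℝ)
    (hUf : ∀ x : Omega d, U x = f (fun i => x (((i : ℕ) : ℤ) + 1)))
    (hnorm : Normalized d U)
    (α : Measure (Omega d)) (hα : IsProbabilityMeasure α)
    (h : QuasiCStarGibbs d U α) :
    ∃ c₂ : ℝ, 0 < c₂ ∧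
      ∀ s : ℕ, 1 ≤ s → ∀ (a : ℕ → Fin d) (x : Omega d),
        (∀ k : ℕ, 1 ≤ k → k ≤ s → x (k : ℤ) = a k) →
        Real.exp (-(birkhoff d U s x)) * (α (futureCyl d s a)).toReal ≤ c₂ := by
  obtain ⟨d₁, d₂, hd₁, -, hq⟩ := h
  obtain ⟨M, hM⟩ : ∃ M : ℝ, ∀ x, |U x| ≤ M := by
    refine ⟨∑ v, |f v|, fun x => ?_⟩
    rw [hUf]
    exact Finset.single_le_sum (f := fun v => |f v|) (fun v _ => abs_nonneg _)
      (Finset.mem_univ _)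
  have hM0 : 0 ≤ M := (abs_nonneg _).trans (hM fun _ => ⟨0, by omega⟩)
  set C : ℝ := 2 * M * ((1 : ℕ) + r) + 4 * M * r with hC
  refine ⟨Real.exp C / d₁, by positivity, fun s hs a x hx => ?_⟩
  have hcomp : ∀ (p : Fin d × Fin d) (w : Fin s → Fin d),
      d₁ * (Real.exp (birkhoff d U s (prependWord d s w x)) *
        (Real.exp (-birkhoff d U s x - C) * α.real (cyl d 1 s (setLetters p x))))
        ≤ α.real (cyl d 1 s (setLetters p (prependWord d s w x))) := fun p w => by
    have h1 := (hq 1 s le_rfl hs (setLetters p x) (setLetters p (prependWord d s w x))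
      (fun _ => 1) continuous_const fun _ => zero_le_one).1
    simp only [mul_one, setIntegral_const, smul_eq_mul] at h1
    have h2 := exp_mul_measureReal_cyl_le hUf hM hM0 hd₁ h1
      (fun j hj _ => (setLetters_of_pos p x hj).symm)
      (fun j hj _ => (setLetters_of_pos p (prependWord d s w x) hj).symm)
    rw [← mul_assoc (Real.exp _), ← Real.exp_add]
    convert h2 using 4
    ring
  have hsum := (Finset.sum_le_sum fun p (_ : p ∈ Finset.univ) =>
    Finset.sum_le_sum fun w (_ : w ∈ Finset.univ) => hcomp p w).trans
      (sum_measureReal_cyl_prependWord_le_one s α x)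
  simp_rw [← Finset.mul_sum, ← Finset.sum_mul, sum_exp_birkhoff_prependWord hUf hnorm, one_mul,
    ← Finset.mul_sum] at hsum
  have hfut : α.real (futureCyl d s a) ≤ _ := measureReal_futureCyl_le_sum α hx
  have h3 : d₁ * (Real.exp (-birkhoff d U s x - C) * α.real (futureCyl d s a)) ≤ 1 :=
    le_trans (by gcongr) hsum
  change Real.exp (-(birkhoff d U s x)) * α.real (futureCyl d s a) ≤ _
  rw [le_div_iff₀ hd₁]
  calc Real.exp (-birkhoff d U s x) * α.real (futureCyl d s a) * d₁
      = Real.exp C * (d₁ * (Real.exp (-birkhoff d U s x - C) * α.real (futureCyl d s a))) := by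
        rw [Real.exp_sub]
        field_simp
    _ ≤ Real.exp C := mul_le_of_le_one_right (Real.exp_pos _).le h3
end
end

section
/- Let r ≥ 1, f : {1,…,d}^r → ℝ, and let U(x) = f(x₁,…,x_r) be a potential depending only on the coordinates x₁,…,x_r. If α₁ and α₂ are both quasi-C*-Gibbs Borel probability measures for U, then there exists a constant C > 0 such that α₁(B) ≤ C · α₂(B) for every Borel set B ⊆ Ω; in particular α₁ is absolutely continuous with respect to α₂ (and, by symmetry, α₁ and α₂ are mutually absolutely continuous). -/
open MeasureTheory Filter
open scoped ENNReal

noncomputable section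

/-- The Birkhoff sum of `U` over all shifts whose range-`r` window can meet `[-n, n]`. -/
def windowSum (d r n : ℕ) (U : Omega d → ℝ) (x : Omega d) : ℝ :=
  ∑ k ∈ Finset.Icc (-(n : ℤ) - r) n, U (tauZ d k x)

lemma apply_tauZ_congr {d r : ℕ} {f : (Fin r → Fin d) → ℝ} {U : Omega d → ℝ}
    (hUf : ∀ x : Omega d, U x = f (fun i => x (((i : ℕ) : ℤ) + 1)))
    {x y : Omega d} {k : ℤ} (h : ∀ j : ℤ, k + 1 ≤ j → j ≤ k + r → x j = y j) :
    U (tauZ d k x) = U (tauZ d k y) := by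
  rw [hUf, hUf]
  congr 1
  funext i
  have hi := i.isLt
  exact h _ (by omega) (by omega)

lemma exists_abs_sub_le {d r : ℕ} {f : (Fin r → Fin d) → ℝ} {U : Omega d → ℝ}
    (hUf : ∀ x : Omega d, U x = f (fun i => x (((i : ℕ) : ℤ) + 1))) :
    ∃ M : ℝ, 0 ≤ M ∧ ∀ x y, |U x - U y| ≤ M := by
  refine ⟨∑ w, |f w| + ∑ w, |f w|, by positivity, fun x y => ?_⟩
  have h : ∀ z, |U z| ≤ ∑ w, |f w| := fun z => by
    rw [hUf]
    exact Finset.single_le_sum (f := fun w => |f w|) (fun _ _ => abs_nonneg _)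
      (Finset.mem_univ _)
  exact (abs_sub _ _).trans (add_le_add (h x) (h y))

lemma windowSum_sub_le {d r : ℕ} {f : (Fin r → Fin d) → ℝ} {U : Omega d → ℝ}
    (hUf : ∀ x : Omega d, U x = f (fun i => x (((i : ℕ) : ℤ) + 1)))
    {M : ℝ} (hM0 : 0 ≤ M) (hM : ∀ x y, |U x - U y| ≤ M) (n : ℕ) {x y : Omega d}
    (h : ∀ j : ℤ, -(n : ℤ) ≤ j → j ≤ n → x j = y j) :
    windowSum d r n U x - windowSum d r n U y ≤ 2 * r * M := by
  classical
  let S : Finset ℤ := Finset.Ico (-(n : ℤ) - r) (-n) ∪ Finset.Ioc ((n : ℤ) - r) n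
  have hS : (S.card : ℝ) ≤ 2 * r := by
    have h1 : S.card ≤ 2 * r := by
      refine (Finset.card_union_le _ _).trans ?_
      rw [Int.card_Ico, Int.card_Ioc]
      omega
    exact_mod_cast h1
  rw [windowSum, windowSum, ← Finset.sum_sub_distrib]
  calc ∑ k ∈ Finset.Icc (-(n : ℤ) - r) n, (U (tauZ d k x) - U (tauZ d k y))
      ≤ ∑ k ∈ Finset.Icc (-(n : ℤ) - r) n, if k ∈ S then M else 0 := by
        refine Finset.sum_le_sum fun k hk => ?_
        split_ifs with hkS
        · exact (le_abs_self _).trans (hM _ _)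
        · simp only [S, Finset.mem_union, Finset.mem_Ico, Finset.mem_Ioc] at hkS
          rw [Finset.mem_Icc] at hk
          rw [apply_tauZ_congr hUf (fun j h1 h2 => h j (by omega) (by omega)), sub_self]
    _ ≤ ∑ k ∈ S, M := by
        rw [← Finset.sum_filter]
        refine Finset.sum_le_sum_of_subset_of_nonneg (fun k hk => ?_) fun _ _ _ => hM0
        exact (Finset.mem_filter.mp hk).2
    _ ≤ 2 * r * M := by
        rw [Finset.sum_const, nsmul_eq_mul]
        gcongr

lemma Vfun_eq_windowSum_sub {d r : ℕ} {f : (Fin r → Fin d) → ℝ} {U : Omega d → ℝ}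
    (hUf : ∀ x : Omega d, U x = f (fun i => x (((i : ℕ) : ℤ) + 1))) (n : ℕ) {x y : Omega d}
    (h : ∀ j : ℤ, ¬ (-(n : ℤ) ≤ j ∧ j ≤ n) → x j = y j) :
    Vfun d U x y = windowSum d r n U x - windowSum d r n U y := by
  rw [Vfun, windowSum, windowSum, ← Finset.sum_sub_distrib]
  refine tsum_eq_sum fun k hk => ?_
  rw [Finset.mem_Icc] at hk
  rw [apply_tauZ_congr hUf (fun j h1 h2 => h j (by omega)), sub_self]

lemma measureReal_cyl_le {d r : ℕ} {f : (Fin r → Fin d) → ℝ} {U : Omega d → ℝ}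
    (hUf : ∀ x : Omega d, U x = f (fun i => x (((i : ℕ) : ℤ) + 1)))
    {α : Measure (Omega d)} [IsProbabilityMeasure α] (hα : QuasiCStarGibbs d U α) :
    ∃ K : ℝ, 0 < K ∧ ∀ n : ℕ, 1 ≤ n → ∀ a b : ℤ → Fin d,
      α.real (cyl d n n b) * Real.exp (windowSum d r n U a) ≤
        K * (α.real (cyl d n n a) * Real.exp (windowSum d r n U b)) := by
  obtain ⟨M, hM0, hM⟩ := exists_abs_sub_le hUf
  obtain ⟨_, d₂, -, hd₂, hq⟩ := hα
  refine ⟨d₂ * Real.exp (4 * r * M), by positivity, fun n hn a b => ?_⟩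
  have hb := (hq n n hn hn a b (fun _ => 1) continuous_const fun _ => zero_le_one).2
  simp only [mul_one, setIntegral_const, smul_eq_mul] at hb
  set E := Real.exp (4 * r * M + windowSum d r n U b - windowSum d r n U a) with hE
  have hint : ∫ z in cyl d n n a, Real.exp (-(Vfun d U z (conjMap d n n b z))) ∂α
      ≤ E * α.real (cyl d n n a) := by
    refine (Real.le_norm_self _).trans
      (norm_setIntegral_le_of_norm_le_const (measure_lt_top _ _) fun z hz => ?_)
    rw [Real.norm_eq_abs, Real.abs_exp, hE, Real.exp_le_exp,
      Vfun_eq_windowSum_sub (r := r) hUf n fun j hj => by simp [conjMap, hj]]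
    have h1 := windowSum_sub_le hUf hM0 hM n (x := a) (y := z)
      fun j hj1 hj2 => (hz j hj1 hj2).symm
    have h2 := windowSum_sub_le hUf hM0 hM n (x := conjMap d n n b z) (y := b)
      fun j hj1 hj2 => by simp [conjMap, hj1, hj2]
    linarith
  calc α.real (cyl d n n b) * Real.exp (windowSum d r n U a)
      ≤ (d₂ * (E * α.real (cyl d n n a))) * Real.exp (windowSum d r n U a) := by
        gcongr
        exact hb.trans (by gcongr)
    _ = _ := by
        rw [hE, Real.exp_sub, Real.exp_add]
        field_simp

/-- The word read by a configuration in the window `[-n, n]`. -/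
def windowWord (d n : ℕ) (x : Omega d) : Finset.Icc (-(n : ℤ)) n → Fin d := fun j => x j

lemma windowWord_preimage_singleton (d n : ℕ) (x : Omega d) :
    windowWord d n ⁻¹' {windowWord d n x} = cyl d n n x := by
  ext z
  simp only [Set.mem_preimage, Set.mem_singleton_iff, cyl, Set.mem_ofPred_eq]
  refine ⟨fun h j h1 h2 => congrFun h ⟨j, Finset.mem_Icc.mpr ⟨h1, h2⟩⟩, fun h => ?_⟩
  funext j
  exact h j (Finset.mem_Icc.mp j.2).1 (Finset.mem_Icc.mp j.2).2

lemma continuous_windowWord (d n : ℕ) : Continuous (windowWord d n) :=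
  continuous_pi fun _ => continuous_apply _

lemma windowWord_surjective {d : ℕ} (hd : 0 < d) (n : ℕ) :
    Function.Surjective (windowWord d n) := fun w =>
  ⟨fun j => if h : j ∈ Finset.Icc (-(n : ℤ)) n then w ⟨j, h⟩ else ⟨0, hd⟩, by
    funext j
    simp only [windowWord, j.2, dif_pos]⟩

lemma measurableSet_windowWord_preimage (d n : ℕ) (T : Set (Finset.Icc (-(n : ℤ)) n → Fin d)) :
    MeasurableSet (windowWord d n ⁻¹' T) :=
  (continuous_windowWord d n).measurable T.toFinite.measurableSet

/-- Two quasi-C*-Gibbs probability measures for the same potential are comparable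
on the window cylinders. -/
lemma exists_measureReal_cyl_le {d r : ℕ} (hd : 0 < d) {f : (Fin r → Fin d) → ℝ}
    {U : Omega d → ℝ} (hUf : ∀ x : Omega d, U x = f (fun i => x (((i : ℕ) : ℤ) + 1)))
    {α₁ α₂ : Measure (Omega d)} [IsProbabilityMeasure α₁] [IsProbabilityMeasure α₂]
    (h₁ : QuasiCStarGibbs d U α₁) (h₂ : QuasiCStarGibbs d U α₂) :
    ∃ C : ℝ, 0 < C ∧ ∀ n : ℕ, 1 ≤ n → ∀ b : Omega d,
      α₁.real (cyl d n n b) ≤ C * α₂.real (cyl d n n b) := by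
  obtain ⟨K₁, hK₁, hc₁⟩ := measureReal_cyl_le hUf h₁
  obtain ⟨K₂, hK₂, hc₂⟩ := measureReal_cyl_le hUf h₂
  refine ⟨K₁ * K₂, by positivity, fun n hn b => ?_⟩
  obtain ⟨e, he⟩ := (windowWord_surjective hd n).hasRightInverse
  have hsum : ∀ α : Measure (Omega d), IsProbabilityMeasure α →
      ∑ w, α.real (cyl d n n (e w)) = 1 := fun α _ => by
    have := sum_measureReal_preimage_singleton (μ := α) (f := windowWord d n) Finset.univ
      fun w _ => measurableSet_windowWord_preimage d n {w}
    simp only [Finset.coe_univ, Set.preimage_univ, probReal_univ] at this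
    rw [← this]
    refine Finset.sum_congr rfl fun w _ => ?_
    rw [← windowWord_preimage_singleton, he w]
  set Z := ∑ w, Real.exp (windowSum d r n U (e w))
  have hZ : 0 < Z := Finset.sum_pos (fun _ _ => Real.exp_pos _) ⟨windowWord d n b, Finset.mem_univ _⟩
  have hu : α₁.real (cyl d n n b) * Z ≤ K₁ * Real.exp (windowSum d r n U b) := by
    have := Finset.sum_le_sum fun w (_ : w ∈ Finset.univ) => hc₁ n hn (e w) b
    rwa [← Finset.mul_sum, ← Finset.mul_sum, ← Finset.sum_mul, hsum α₁ ‹_›, one_mul] at this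
  have hl : Real.exp (windowSum d r n U b) ≤ K₂ * (α₂.real (cyl d n n b) * Z) := by
    have := Finset.sum_le_sum fun w (_ : w ∈ Finset.univ) => hc₂ n hn b (e w)
    rwa [← Finset.mul_sum, ← Finset.mul_sum, ← Finset.sum_mul, hsum α₂ ‹_›, one_mul] at this
  refine le_of_mul_le_mul_right ?_ hZ
  calc α₁.real (cyl d n n b) * Z ≤ K₁ * Real.exp (windowSum d r n U b) := hu
    _ ≤ K₁ * (K₂ * (α₂.real (cyl d n n b) * Z)) := by gcongr
    _ = K₁ * K₂ * α₂.real (cyl d n n b) * Z := by ring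

lemma exists_cyl_subset {d : ℕ} {G : Set (Omega d)} (hG : IsOpen G) {x : Omega d} (hx : x ∈ G) :
    ∃ n : ℕ, cyl d n n x ⊆ G := by
  obtain ⟨I, u, hu, hIG⟩ := isOpen_pi_iff.mp hG x hx
  refine ⟨∑ j ∈ I, j.natAbs, fun z hz => hIG fun j hj => ?_⟩
  have hle : j.natAbs ≤ ∑ j ∈ I, j.natAbs :=
    Finset.single_le_sum (f := Int.natAbs) (fun _ _ => Nat.zero_le _) hj
  rw [hz j (by omega) (by omega)]
  exact (hu j hj).2

lemma cyl_anti {d n m : ℕ} (h : n ≤ m) (x : Omega d) : cyl d m m x ⊆ cyl d n n x :=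
  fun _ hz j h1 h2 => hz j (by omega) (by omega)

/-- A measure bounded by another on all large window cylinders is bounded by it on Borel sets. -/
lemma le_of_cyl_le {d : ℕ} (hd : 0 < d) {μ ν : Measure (Omega d)} [IsFiniteMeasure ν]
    (h : ∀ n : ℕ, 1 ≤ n → ∀ x, μ (cyl d n n x) ≤ ν (cyl d n n x)) : μ ≤ ν := by
  have hpre : ∀ n : ℕ, 1 ≤ n → ∀ T : Set (Finset.Icc (-(n : ℤ)) n → Fin d),
      μ (windowWord d n ⁻¹' T) ≤ ν (windowWord d n ⁻¹' T) := fun n hn T => by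
    have hT := T.toFinite.coe_toFinset
    rw [← hT,
      ← sum_measure_preimage_singleton _ fun w _ => measurableSet_windowWord_preimage d n {w},
      ← sum_measure_preimage_singleton _ fun w _ => measurableSet_windowWord_preimage d n {w}]
    refine Finset.sum_le_sum fun w _ => ?_
    obtain ⟨x, rfl⟩ := windowWord_surjective hd n w
    rw [windowWord_preimage_singleton]
    exact h n hn x
  have hopen : ∀ G : Set (Omega d), IsOpen G → μ G ≤ ν G := fun G hG => by
    let A : ℕ → Set (Omega d) := fun n => {x | cyl d (n + 1) (n + 1) x ⊆ G}
    have hA : Monotone A := fun n m hnm x hx => (cyl_anti (by omega) x).trans hx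
    have hAG : ⋃ n, A n = G := by
      refine Set.Subset.antisymm (Set.iUnion_subset fun n x hx => hx fun _ _ _ => rfl)
        fun x hx => ?_
      obtain ⟨n, hn⟩ := exists_cyl_subset hG hx
      exact Set.mem_iUnion.mpr ⟨n, (cyl_anti n.le_succ x).trans hn⟩
    have hAn : ∀ n, windowWord d (n + 1) ⁻¹' (windowWord d (n + 1) '' A n) = A n := fun n => by
      refine Set.Subset.antisymm ?_ (Set.subset_preimage_image _ _)
      rintro x ⟨y, hy, hyx⟩
      have : cyl d (n + 1) (n + 1) x = cyl d (n + 1) (n + 1) y := by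
        rw [← windowWord_preimage_singleton, ← hyx, windowWord_preimage_singleton]
      exact this.trans_subset hy
    rw [← hAG, hA.measure_iUnion]
    refine iSup_le fun n => ?_
    rw [← hAn n]
    refine (hpre (n + 1) (by omega) _).trans (measure_mono ?_)
    rw [hAn n]
    exact Set.subset_iUnion A n
  refine Measure.le_iff.mpr fun B _ => ?_
  rw [B.measure_eq_iInf_isOpen ν]
  exact le_iInf₂ fun G hBG => le_iInf fun hG => (measure_mono hBG).trans (hopen G hG)

/-- two quasi-C*-Gibbs probabilities for a finite-range potential
are comparable (`α₁ B ≤ C α₂ B` for all Borel `B`), hence mutually absolutely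
continuous. -/
theorem quasiGibbs_absolutelyContinuous (d : ℕ) (hd : 2 ≤ d) (r : ℕ) (hr : 1 ≤ r)
    (f : (Fin r → Fin d) → ℝ) (U : Omega d → ℝ)
    (hUf : ∀ x : Omega d, U x = f (fun i => x (((i : ℕ) : ℤ) + 1)))
    (α₁ α₂ : Measure (Omega d)) (hα₁ : IsProbabilityMeasure α₁)
    (hα₂ : IsProbabilityMeasure α₂)
    (h₁ : QuasiCStarGibbs d U α₁) (h₂ : QuasiCStarGibbs d U α₂) :
    (∃ C : ℝ, 0 < C ∧ ∀ B : Set (Omega d), MeasurableSet B →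
        α₁ B ≤ ENNReal.ofReal C * α₂ B) ∧
      α₁ ≪ α₂ := by
  have hd0 : 0 < d := by omega
  obtain ⟨C, hC, hcyl⟩ := exists_measureReal_cyl_le hd0 hUf h₁ h₂
  have hle : α₁ ≤ ENNReal.ofReal C • α₂ := by
    have : IsFiniteMeasure (ENNReal.ofReal C • α₂) := α₂.smul_finite ENNReal.ofReal_ne_top
    refine le_of_cyl_le hd0 fun n hn x => ?_
    rw [Measure.smul_apply, smul_eq_mul, ← ofReal_measureReal, ← ofReal_measureReal (μ := α₂),
      ← ENNReal.ofReal_mul hC.le]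
    exact ENNReal.ofReal_le_ofReal (hcyl n hn x)
  exact ⟨⟨C, hC, fun B _ => hle B⟩, Measure.absolutelyContinuous_of_le_smul hle⟩
end
end

section
/- Let U : Ω → ℝ be a potential depending on only finitely many coordinates. If the Borel probability measure α on Ω is C*-Gibbs for U, then α is invariant under the shift τ, i.e., α(τ^{−1}(B)) = α(B) for every Borel set B ⊆ Ω. -/
open MeasureTheory Filter
open scoped ENNReal

noncomputable section

/-- `U` only depends on the coordinates `j` with `|j| ≤ R`. -/
def HasRange (d : ℕ) (U : Omega d → ℝ) (R : ℕ) : Prop :=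
  ∀ x y : Omega d, (∀ j : ℤ, |j| ≤ (R : ℤ) → x j = y j) → U x = U y

/-- The cylinder of the points that agree with `x` on `F`. -/
def finCyl {d : ℕ} (F : Finset ℤ) (x : Omega d) : Set (Omega d) :=
  {z | ∀ j ∈ F, z j = x j}

/-- Replace the coordinates of `x` in `K` by those of `g`. -/
def overwrite {d : ℕ} (K : Finset ℤ) (g : K → Fin d) (x : Omega d) : Omega d :=
  fun j => if h : j ∈ K then g ⟨j, h⟩ else x j

theorem overwrite_of_mem {d : ℕ} {K : Finset ℤ} (g : K → Fin d) (x : Omega d) {j : ℤ}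
    (h : j ∈ K) : overwrite K g x j = g ⟨j, h⟩ := dif_pos h

theorem overwrite_of_notMem {d : ℕ} {K : Finset ℤ} (g : K → Fin d) (x : Omega d) {j : ℤ}
    (h : j ∉ K) : overwrite K g x j = x j := dif_neg h

/-- Weights `p F x` of the cylinders `finCyl F x` that are nonnegative, additive, and transform
under homoclinic changes as prescribed by `V`. -/
structure IsGibbsFamily (d : ℕ) (U : Omega d → ℝ) (R : ℕ)
    (p : Finset ℤ → Omega d → ℝ) : Prop where
  nonneg : ∀ F x, 0 ≤ p F x
  sum_eq : ∀ F K : Finset ℤ, Disjoint F K → ∀ x,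
    p F x = ∑ g : K → Fin d, p (F ∪ K) (overwrite K g x)
  gibbs : ∀ (F : Finset ℤ) (x y : Omega d),
    (∀ j, x j ≠ y j → ∀ i, |i - j| ≤ 2 * (R : ℤ) → i ∈ F) →
      p F y = Real.exp (-(Vfun d U x y)) * p F x

theorem exists_abs_le_of_mem (s : Finset ℤ) : ∃ n : ℕ, ∀ j ∈ s, |j| ≤ (n : ℤ) := by
  refine ⟨s.sup Int.natAbs, fun j hj => ?_⟩
  rw [Int.abs_eq_natAbs]
  exact_mod_cast Finset.le_sup (f := Int.natAbs) hj

theorem FiniteRange.exists_hasRange {d : ℕ} {U : Omega d → ℝ} (hU : FiniteRange d U) :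
    ∃ R : ℕ, HasRange d U R := by
  obtain ⟨s, hs⟩ := hU
  obtain ⟨R, hR⟩ := exists_abs_le_of_mem s
  exact ⟨R, fun x y h => hs x y fun j hj => h j (hR j hj)⟩

theorem HasRange.exists_abs_le {d : ℕ} (hd : 0 < d) {U : Omega d → ℝ} {R : ℕ}
    (hU : HasRange d U R) : ∃ B : ℝ, 0 ≤ B ∧ ∀ x, |U x| ≤ B := by
  let K : Finset ℤ := Finset.Icc (-(R : ℤ)) R
  let x₀ : Omega d := fun _ => ⟨0, hd⟩
  have key : ∀ x, U x = U (overwrite K (fun j => x j) x₀) := fun x => hU _ _ fun j hj => by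
    rw [overwrite_of_mem]
    exact Finset.mem_Icc.2 (abs_le.1 hj)
  refine ⟨∑ g : K → Fin d, |U (overwrite K g x₀)|,
    Finset.sum_nonneg fun _ _ => abs_nonneg _, fun x => ?_⟩
  rw [key x]
  exact Finset.single_le_sum (f := fun g : K → Fin d => |U (overwrite K g x₀)|)
    (fun _ _ => abs_nonneg _) (Finset.mem_univ _)

section Potential

variable {d : ℕ} {U : Omega d → ℝ} {R : ℕ}

theorem HasRange.term_eq_zero (hU : HasRange d U R) {x y : Omega d} {k : ℤ}
    (h : ∀ j, |j - k| ≤ (R : ℤ) → x j = y j) : U (tauZ d k x) - U (tauZ d k y) = 0 :=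
  sub_eq_zero.2 <| hU _ _ fun j hj => h _ (by simpa using hj)

theorem HasRange.Vfun_congr (hU : HasRange d U R) {x y x' y' : Omega d}
    (hloc : ∀ j, x j ≠ y j → ∀ i, |i - j| ≤ 2 * (R : ℤ) → x i = x' i ∧ y i = y' i)
    (heq : ∀ j, x j = y j → x' j = y' j) : Vfun d U x y = Vfun d U x' y' := by
  refine tsum_congr fun k => ?_
  by_cases h : ∀ j, |j - k| ≤ (R : ℤ) → x j = y j
  · rw [hU.term_eq_zero h, hU.term_eq_zero fun j hj => heq j (h j hj)]
  · push Not at h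
    obtain ⟨j, hj, hne⟩ := h
    have hi : ∀ i : ℤ, |i| ≤ (R : ℤ) → |i + k - j| ≤ 2 * (R : ℤ) := fun i hi => by
      rw [abs_le] at *
      constructor <;> linarith [hi.1, hi.2, hj.1, hj.2]
    rw [hU (tauZ d k x) (tauZ d k x') fun i h => (hloc j hne (i + k) (hi i h)).1,
      hU (tauZ d k y) (tauZ d k y') fun i h => (hloc j hne (i + k) (hi i h)).2]

theorem HasRange.summable (hU : HasRange d U R) {n : ℕ} {x y : Omega d}
    (h : ∀ j, x j ≠ y j → |j| ≤ (n : ℤ)) :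
    Summable fun k : ℤ => U (tauZ d k x) - U (tauZ d k y) := by
  refine summable_of_ne_finset_zero (s := Finset.Icc (-(n + R : ℤ)) (n + R)) fun k hk => ?_
  refine hU.term_eq_zero fun j hj => ?_
  by_contra hne
  have := h j hne
  rw [Finset.mem_Icc] at hk
  rw [abs_le] at *
  exact hk ⟨by linarith, by linarith⟩

/-- Bounded distortion: changing both points outside `[-n, n]` alters `V` by an amount that is
bounded independently of `n`. -/
theorem HasRange.Vfun_sub_le (hU : HasRange d U R) {B : ℝ} (hB : ∀ x, |U x| ≤ B)
    {n : ℕ} {x y x' y' : Omega d}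
    (hx : ∀ j, |j| ≤ (n : ℤ) → x j = x' j) (hy : ∀ j, |j| ≤ (n : ℤ) → y j = y' j)
    (h : ∀ j, x j ≠ y j → |j| ≤ (n : ℤ)) (h' : ∀ j, x' j ≠ y' j → |j| ≤ (n : ℤ)) :
    Vfun d U x' y' - Vfun d U x y ≤ (2 * (2 * R + 1)) * (4 * B) := by
  let S : Finset ℤ := Finset.Icc (-(n + R : ℤ)) (-n + R) ∪ Finset.Icc ((n : ℤ) - R) (n + R)
  have hS : (S.card : ℝ) ≤ 2 * (2 * R + 1) := by
    have := Finset.card_union_le (Finset.Icc (-(n + R : ℤ)) (-n + R))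
      (Finset.Icc ((n : ℤ) - R) (n + R))
    rw [Int.card_Icc, Int.card_Icc] at this
    have h2 : S.card ≤ 2 * (2 * R + 1) := this.trans (by omega)
    exact_mod_cast h2
  have hB0 : 0 ≤ B := (abs_nonneg _).trans (hB x)
  rw [Vfun, Vfun, ← (hU.summable h').tsum_sub (hU.summable h), tsum_eq_sum (s := S)]
  · refine (Finset.sum_le_card_nsmul _ _ (4 * B) fun k _ => ?_).trans ?_
    · have h1 := abs_le.1 (hB (tauZ d k x))
      have h2 := abs_le.1 (hB (tauZ d k y))
      have h3 := abs_le.1 (hB (tauZ d k x'))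
      have h4 := abs_le.1 (hB (tauZ d k y'))
      linarith [h1.1, h2.2, h3.2, h4.1]
    · rw [nsmul_eq_mul]
      exact mul_le_mul_of_nonneg_right hS (by linarith)
  · intro k hk
    simp only [S, Finset.mem_union, Finset.mem_Icc] at hk
    by_cases hin : |k| + R ≤ (n : ℤ)
    · have hmem : ∀ j : ℤ, |j| ≤ (R : ℤ) → |j + k| ≤ (n : ℤ) := fun j hj =>
        (abs_add_le j k).trans (by linarith)
      rw [hU (tauZ d k x) (tauZ d k x') fun j hj => hx _ (hmem j hj),
        hU (tauZ d k y) (tauZ d k y') fun j hj => hy _ (hmem j hj), sub_self]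
    · have hout : ∀ j, |j - k| ≤ (R : ℤ) → ¬ |j| ≤ (n : ℤ) := fun j hj hj' => by
        rw [abs_le] at hj hj'
        rcases abs_cases k with hc | hc <;> omega
      rw [hU.term_eq_zero fun j hj => not_not.1 (mt (h' j) (hout j hj)),
        hU.term_eq_zero fun j hj => not_not.1 (mt (h j) (hout j hj)), sub_self]

theorem Vfun_shift (x y : Omega d) : Vfun d U (tauZ d 1 x) (tauZ d 1 y) = Vfun d U x y := by
  have h : ∀ (k : ℤ) (z : Omega d), tauZ d k (tauZ d 1 z) = tauZ d (k + 1) z := fun k z => by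
    funext j
    simp only [tauZ, add_assoc]
  simp only [Vfun, h]
  exact (Equiv.addRight (1 : ℤ)).tsum_eq fun k => U (tauZ d k x) - U (tauZ d k y)

theorem IsGibbsFamily.le_of_Icc_le {p q : Finset ℤ → Omega d → ℝ} {a b : ℝ}
    (hp : IsGibbsFamily d U R p) (hq : IsGibbsFamily d U R q)
    (h : ∀ (n : ℕ) x, a * q (Finset.Icc (-(n : ℤ)) n) x ≤ b * p (Finset.Icc (-(n : ℤ)) n) x)
    (F : Finset ℤ) (x : Omega d) : a * q F x ≤ b * p F x := by
  obtain ⟨n, hn⟩ : ∃ n : ℕ, F ⊆ Finset.Icc (-(n : ℤ)) n := by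
    obtain ⟨n, hn⟩ := exists_abs_le_of_mem F
    exact ⟨n, fun j hj => Finset.mem_Icc.2 (abs_le.1 (hn j hj))⟩
  have hdisj : Disjoint F (Finset.Icc (-(n : ℤ)) n \ F) := Finset.disjoint_sdiff
  rw [hp.sum_eq F _ hdisj, hq.sum_eq F _ hdisj, Finset.union_sdiff_of_subset hn,
    Finset.mul_sum, Finset.mul_sum]
  exact Finset.sum_le_sum fun g _ => h n _

theorem IsGibbsFamily.dominates_Icc (hU : HasRange d U R) {B : ℝ} (hB : ∀ x, |U x| ≤ B)
    {p q : Finset ℤ → Omega d → ℝ} {a b : ℝ}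
    (hp : IsGibbsFamily d U R p) (hq : IsGibbsFamily d U R q)
    (hpa : ∀ x, p ∅ x = a) (hqb : ∀ x, q ∅ x = b) (n : ℕ) (x : Omega d) :
    a * q (Finset.Icc (-(n : ℤ)) n) x
      ≤ (Real.exp ((2 * (2 * R + 1)) * (4 * B)) * b) * p (Finset.Icc (-(n : ℤ)) n) x := by
  set D : ℝ := (2 * (2 * R + 1)) * (4 * B) with hD
  set I : Finset ℤ := Finset.Icc (-(n : ℤ)) n with hI
  set J : Finset ℤ := Finset.Icc (-(n + 2 * R : ℤ)) (n + 2 * R) with hJ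
  set K : Finset ℤ := J \ I with hK
  have hIJ : I ⊆ J := Finset.Icc_subset_Icc (by omega) (by omega)
  have hunion : I ∪ K = J := Finset.union_sdiff_of_subset hIJ
  have hdisj : Disjoint I K := Finset.disjoint_sdiff
  have memI : ∀ {j : ℤ}, j ∈ I ↔ |j| ≤ (n : ℤ) := by
    intro j
    rw [hI, Finset.mem_Icc, abs_le]
  have cross : ∀ (y : Omega d), (∀ j, x j ≠ y j → j ∈ I) → ∀ w w' : K → Fin d,
      p J (overwrite K w y) * q J (overwrite K w' x)
        ≤ Real.exp D * (p J (overwrite K w x) * q J (overwrite K w' y)) := by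
    intro y hy w w'
    have hne : ∀ (v : K → Fin d) (j : ℤ), overwrite K v x j ≠ overwrite K v y j → j ∈ I := by
      intro v j hj
      by_cases hjK : j ∈ K
      · rw [overwrite_of_mem _ _ hjK, overwrite_of_mem _ _ hjK] at hj
        exact absurd rfl hj
      · rw [overwrite_of_notMem _ _ hjK, overwrite_of_notMem _ _ hjK] at hj
        exact hy j hj
    have hnear : ∀ (v : K → Fin d) (j : ℤ), overwrite K v x j ≠ overwrite K v y j →
        ∀ i, |i - j| ≤ 2 * (R : ℤ) → i ∈ J := by
      intro v j hj i hi
      have := hne v j hj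
      rw [memI, abs_le] at this
      rw [abs_le] at hi
      rw [hJ, Finset.mem_Icc]
      omega
    have hagree : ∀ (z : Omega d) (j : ℤ), |j| ≤ (n : ℤ) →
        overwrite K w z j = overwrite K w' z j := by
      intro z j hj
      have hjK : j ∉ K := Finset.disjoint_left.1 hdisj (memI.2 hj)
      rw [overwrite_of_notMem _ _ hjK, overwrite_of_notMem _ _ hjK]
    have hV := hU.Vfun_sub_le hB (hagree x) (hagree y)
      (fun j hj => memI.1 (hne w j hj)) (fun j hj => memI.1 (hne w' j hj))
    rw [hp.gibbs J _ _ (hnear w), hq.gibbs J _ _ (hnear w')]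
    have hexp : Real.exp (-(Vfun d U (overwrite K w x) (overwrite K w y)))
        ≤ Real.exp D * Real.exp (-(Vfun d U (overwrite K w' x) (overwrite K w' y))) := by
      rw [← Real.exp_add]
      exact Real.exp_le_exp.2 (by linarith)
    calc _ = Real.exp (-(Vfun d U (overwrite K w x) (overwrite K w y)))
            * (p J (overwrite K w x) * q J (overwrite K w' x)) := by ring
      _ ≤ Real.exp D * Real.exp (-(Vfun d U (overwrite K w' x) (overwrite K w' y)))
            * (p J (overwrite K w x) * q J (overwrite K w' x)) :=
          mul_le_mul_of_nonneg_right hexp (mul_nonneg (hp.nonneg _ _) (hq.nonneg _ _))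
      _ = _ := by ring
  have inner : ∀ y : Omega d, (∀ j, x j ≠ y j → j ∈ I) →
      p I y * q I x ≤ Real.exp D * (p I x * q I y) := by
    intro y hy
    rw [hp.sum_eq I K hdisj y, hq.sum_eq I K hdisj x, hp.sum_eq I K hdisj x,
      hq.sum_eq I K hdisj y, hunion, Finset.sum_mul_sum, Finset.sum_mul_sum, Finset.mul_sum]
    refine Finset.sum_le_sum fun w _ => ?_
    rw [Finset.mul_sum]
    exact Finset.sum_le_sum fun w' _ => cross y hy w w'
  have hsum : ∀ {r : Finset ℤ → Omega d → ℝ}, IsGibbsFamily d U R r →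
      r ∅ x = ∑ g : I → Fin d, r I (overwrite I g x) := fun hr => by
    have := hr.sum_eq ∅ I (Finset.disjoint_empty_left I) x
    rwa [Finset.empty_union] at this
  rw [← hpa x, ← hqb x, hsum hp, hsum hq, Finset.sum_mul, mul_assoc, Finset.sum_mul,
    Finset.mul_sum]
  refine Finset.sum_le_sum fun g _ => (inner _ fun j hj => ?_).trans_eq (by ring)
  by_contra hjI
  exact hj (overwrite_of_notMem g x hjI).symm

theorem IsGibbsFamily.sub_const_mul {p q : Finset ℤ → Omega d → ℝ} {c : ℝ}
    (hp : IsGibbsFamily d U R p) (hq : IsGibbsFamily d U R q)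
    (h : ∀ F x, c * q F x ≤ p F x) : IsGibbsFamily d U R fun F x => p F x - c * q F x where
  nonneg F x := sub_nonneg.2 (h F x)
  sum_eq F K hFK x := by
    rw [hp.sum_eq F K hFK, hq.sum_eq F K hFK, Finset.mul_sum, Finset.sum_sub_distrib]
  gibbs F x y hxy := by
    rw [hp.gibbs F x y hxy, hq.gibbs F x y hxy]
    ring

/-- Normalized Gibbs families for a finite-range potential are comparable with constant `1`:
subtract from `p` ever larger multiples of `q`. -/
theorem IsGibbsFamily.le (hd : 0 < d) (hU : HasRange d U R) {p q : Finset ℤ → Omega d → ℝ}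
    (hp : IsGibbsFamily d U R p) (hq : IsGibbsFamily d U R q)
    (hp1 : ∀ x, p ∅ x = 1) (hq1 : ∀ x, q ∅ x = 1) (F : Finset ℤ) (x : Omega d) :
    q F x ≤ p F x := by
  obtain ⟨B, hB0, hB⟩ := hU.exists_abs_le hd
  set D : ℝ := (2 * (2 * R + 1)) * (4 * B) with hD
  set ε : ℝ := Real.exp (-D) with hε
  have hε0 : 0 < ε := Real.exp_pos _
  have hε1 : ε ≤ 1 := Real.exp_le_one_iff.2 (neg_nonpos.2 (by positivity))
  have hεD : ε * Real.exp D = 1 := by rw [hε, ← Real.exp_add, neg_add_cancel, Real.exp_zero]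
  have step : ∀ k : ℕ, ∀ F x, (1 - (1 - ε) ^ k) * q F x ≤ p F x := by
    intro k
    induction k with
    | zero =>
      intro F x
      simpa using hp.nonneg F x
    | succ k ih =>
      intro F x
      have hr := hp.sub_const_mul hq ih
      have hdom := hr.le_of_Icc_le hq
        (hr.dominates_Icc hU hB hq (a := (1 - ε) ^ k) (b := 1)
          (fun x => by rw [hp1, hq1]; ring) hq1) F x
      have := mul_le_mul_of_nonneg_left hdom hε0.le
      rw [← hD, mul_one, ← mul_assoc ε (Real.exp D), hεD, one_mul] at this
      rw [pow_succ]
      linarith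
  have hlim : Tendsto (fun k : ℕ => (1 - (1 - ε) ^ k) * q F x) atTop (nhds ((1 - 0) * q F x)) :=
    ((tendsto_pow_atTop_nhds_zero_of_lt_one (by linarith) (by linarith)).const_sub 1).mul_const _
  rw [sub_zero, one_mul] at hlim
  exact le_of_tendsto' hlim fun k => step k F x

end Potential

section Measures

variable {d : ℕ}

theorem measurableSet_finCyl (F : Finset ℤ) (x : Omega d) : MeasurableSet (finCyl F x) := by
  have : finCyl F x = ⋂ j ∈ F, (fun z : Omega d => z j) ⁻¹' {x j} := by
    ext z
    simp [finCyl]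
  rw [this]
  exact F.measurableSet_biInter fun j _ => measurable_pi_apply j (measurableSet_singleton _)

theorem isClopen_finCyl (F : Finset ℤ) (x : Omega d) : IsClopen (finCyl F x) := by
  have : finCyl F x = ⋂ j ∈ F, (fun z : Omega d => z j) ⁻¹' {x j} := by
    ext z
    simp [finCyl]
  rw [this]
  exact isClopen_biInter_finset fun j _ => (isClopen_discrete _).preimage (continuous_apply j)

theorem measureReal_finCyl_eq_sum (α : Measure (Omega d)) [IsFiniteMeasure α]
    {F K : Finset ℤ} (hFK : Disjoint F K) (x : Omega d) :
    α.real (finCyl F x) = ∑ g : K → Fin d, α.real (finCyl (F ∪ K) (overwrite K g x)) := by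
  have hmem : ∀ (g : K → Fin d) (z : Omega d), z ∈ finCyl (F ∪ K) (overwrite K g x) ↔
      z ∈ finCyl F x ∧ ∀ j : K, z j = g j := by
    intro g z
    constructor
    · refine fun h => ⟨fun j hj => ?_, fun j => ?_⟩
      · rw [h j (Finset.mem_union_left _ hj),
          overwrite_of_notMem _ _ (Finset.disjoint_left.1 hFK hj)]
      · rw [h j (Finset.mem_union_right _ j.2), overwrite_of_mem _ _ j.2]
    · rintro ⟨h1, h2⟩ j hj
      by_cases hjK : j ∈ K
      · rw [overwrite_of_mem _ _ hjK]
        exact h2 ⟨j, hjK⟩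
      · rw [overwrite_of_notMem _ _ hjK]
        exact h1 j ((Finset.mem_union.1 hj).resolve_right hjK)
  have hunion : finCyl F x = ⋃ g : K → Fin d, finCyl (F ∪ K) (overwrite K g x) := by
    ext z
    simp only [Set.mem_iUnion, hmem]
    exact ⟨fun h => ⟨fun j => z j, h, fun _ => rfl⟩, fun ⟨_, h, _⟩ => h⟩
  rw [hunion]
  refine measureReal_iUnion_fintype (fun g g' hg => ?_) fun g => measurableSet_finCyl _ _
  refine Set.disjoint_left.2 fun z hz hz' => hg ?_
  funext j
  rw [← ((hmem g z).1 hz).2 j, ((hmem g' z).1 hz').2 j]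

theorem CStarGibbs.measureReal_Icc {U : Omega d → ℝ} {R : ℕ} (hU : HasRange d U R)
    {α : Measure (Omega d)} [IsFiniteMeasure α] (hG : CStarGibbs d U α) {n : ℕ} (hn : 1 ≤ n)
    {x y : Omega d} (hxy : ∀ j, x j ≠ y j → |j| ≤ (n : ℤ)) :
    α.real (finCyl (Finset.Icc (-(n + 2 * R : ℤ)) (n + 2 * R)) y)
      = Real.exp (-(Vfun d U x y))
        * α.real (finCyl (Finset.Icc (-(n + 2 * R : ℤ)) (n + 2 * R)) x) := by
  set F : Finset ℤ := Finset.Icc (-(n + 2 * R : ℤ)) (n + 2 * R) with hF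
  have hsub : ∀ z : Omega d, finCyl F z ⊆ cyl d n n z := fun z w hw j h1 h2 =>
    hw j (Finset.mem_Icc.2 ⟨by omega, by omega⟩)
  have hcyl : ∀ z : Omega d, MeasurableSet (cyl d n n z) := fun z => by
    have : cyl d n n z = finCyl (Finset.Icc (-(n : ℤ)) n) z := by
      ext w
      simp [cyl, finCyl]
    rw [this]
    exact measurableSet_finCyl _ _
  have h := hG n hn x y ((finCyl F y).indicator fun _ => (1 : ℂ))
    (continuous_const.indicator (by simp [(isClopen_finCyl F y).frontier_eq]))
  have hL : Set.EqOn
      (fun z => (Real.exp (-(Vfun d U z (conjMap d n n y z))) : ℂ)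
        * (finCyl F y).indicator (fun _ => (1 : ℂ)) (conjMap d n n y z))
      ((finCyl F x).indicator fun _ => (Real.exp (-(Vfun d U x y)) : ℂ)) (cyl d n n x) := by
    intro z hz
    have hout : ∀ j, ¬ |j| ≤ (n : ℤ) → conjMap d n n y z j = z j := fun j hj =>
      if_neg (by rwa [← abs_le])
    have hin : ∀ j, |j| ≤ (n : ℤ) → conjMap d n n y z j = y j := fun j hj =>
      if_pos (abs_le.1 hj)
    have hxy' : ∀ j, ¬ |j| ≤ (n : ℤ) → x j = y j := fun j hj => not_not.1 (mt (hxy j) hj)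
    have hzx : ∀ j, |j| ≤ (n : ℤ) → z j = x j := fun j hj =>
      hz j (abs_le.1 hj).1 (abs_le.1 hj).2
    have hiff : conjMap d n n y z ∈ finCyl F y ↔ z ∈ finCyl F x := by
      refine forall₂_congr fun j _ => ?_
      by_cases hj : |j| ≤ (n : ℤ)
      · simp only [hin j hj, hzx j hj]
      · rw [hout j hj, hxy' j hj]
    by_cases hzF : z ∈ finCyl F x
    · have hV : Vfun d U x y = Vfun d U z (conjMap d n n y z) := by
        refine hU.Vfun_congr (fun j hj i hi => ?_) fun j hj => ?_
        · have hiF : i ∈ F := by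
            have := abs_le.1 (hxy j hj)
            rw [abs_le] at hi
            rw [hF, Finset.mem_Icc]
            omega
          exact ⟨(hzF i hiF).symm, (hiff.2 hzF i hiF).symm⟩
        · by_cases hjn : |j| ≤ (n : ℤ)
          · rw [hzx j hjn, hin j hjn, hj]
          · rw [hout j hjn]
      simp only [Set.indicator_of_mem hzF, Set.indicator_of_mem (hiff.2 hzF), mul_one, hV]
    · simp only [Set.indicator_of_notMem hzF, Set.indicator_of_notMem (mt hiff.1 hzF), mul_zero]
  rw [setIntegral_congr_fun (hcyl x) hL, setIntegral_indicator (measurableSet_finCyl F x),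
    setIntegral_indicator (measurableSet_finCyl F y), Set.inter_eq_self_of_subset_right (hsub x),
    Set.inter_eq_self_of_subset_right (hsub y), setIntegral_const, setIntegral_const] at h
  have h' := congrArg Complex.re h
  simp only [Complex.real_smul, mul_one, ← Complex.ofReal_mul, Complex.ofReal_re] at h'
  rw [← h', mul_comm]

theorem CStarGibbs.isGibbsFamily {U : Omega d → ℝ} {R : ℕ} (hU : HasRange d U R)
    {α : Measure (Omega d)} [IsFiniteMeasure α] (hG : CStarGibbs d U α) :
    IsGibbsFamily d U R fun F x => α.real (finCyl F x) where
  nonneg _ _ := measureReal_nonneg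
  sum_eq _ _ hFK x := measureReal_finCyl_eq_sum α hFK x
  gibbs F x y hxy := by
    obtain ⟨n, hn1, hFn⟩ : ∃ n : ℕ, 1 ≤ n ∧ ∀ j ∈ F, |j| ≤ (n : ℤ) := by
      obtain ⟨n, hn⟩ := exists_abs_le_of_mem F
      exact ⟨n + 1, by omega, fun j hj => (hn j hj).trans (by omega)⟩
    set J : Finset ℤ := Finset.Icc (-(n + 2 * R : ℤ)) (n + 2 * R) with hJ
    have hFJ : F ⊆ J := fun j hj => by
      have := abs_le.1 (hFn j hj)
      rw [hJ, Finset.mem_Icc]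
      omega
    have hdisj : Disjoint F (J \ F) := Finset.disjoint_sdiff
    have hself : ∀ j, x j ≠ y j → j ∈ F := fun j hj => hxy j hj j (by simp)
    rw [measureReal_finCyl_eq_sum α hdisj x, measureReal_finCyl_eq_sum α hdisj y,
      Finset.union_sdiff_of_subset hFJ, Finset.mul_sum]
    refine Finset.sum_congr rfl fun g _ => ?_
    have heq : ∀ j, x j = y j → overwrite (J \ F) g x j = overwrite (J \ F) g y j := by
      intro j hj
      simp only [overwrite, hj]
    have hF : ∀ (z : Omega d), ∀ j ∈ F, z j = overwrite (J \ F) g z j := fun z j hj =>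
      (overwrite_of_notMem g z (Finset.disjoint_left.1 hdisj hj)).symm
    rw [hG.measureReal_Icc hU hn1 fun j hj =>
        hFn j (hself j (mt (heq j) hj)),
      hU.Vfun_congr (fun j hj i hi => ⟨hF x i (hxy j hj i hi), hF y i (hxy j hj i hi)⟩) heq]

theorem measurable_tau : Measurable (tau d) :=
  measurable_pi_lambda _ fun j => measurable_pi_apply (j + 1)

theorem tau_preimage_finCyl (F : Finset ℤ) (x : Omega d) :
    tau d ⁻¹' finCyl F x = finCyl (F.map (Equiv.addRight (1 : ℤ)).toEmbedding)
      (tauZ d (-1) x) := by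
  ext z
  change (∀ j ∈ F, z (j + 1) = x j) ↔ ∀ j ∈ F.map _, z j = x (j + -1)
  simp only [Finset.forall_mem_map, Equiv.coe_toEmbedding, Equiv.coe_addRight,
    add_neg_cancel_right]

theorem IsGibbsFamily.map_tau {U : Omega d → ℝ} {R : ℕ} {α : Measure (Omega d)}
    [IsFiniteMeasure α] (h : IsGibbsFamily d U R fun F x => α.real (finCyl F x)) :
    IsGibbsFamily d U R fun F x => (α.map (tau d)).real (finCyl F x) where
  nonneg _ _ := measureReal_nonneg
  sum_eq _ _ hFK x := measureReal_finCyl_eq_sum _ hFK x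
  gibbs F x y hxy := by
    have hV : Vfun d U (tauZ d (-1) x) (tauZ d (-1) y) = Vfun d U x y := by
      rw [← Vfun_shift]
      congr 1 <;> funext j <;> simp [tauZ]
    simp only [map_measureReal_apply measurable_tau (measurableSet_finCyl _ _),
      tau_preimage_finCyl]
    rw [← hV]
    refine h.gibbs _ _ _ fun j hj i hi => ?_
    have := hxy (j + -1) hj (i - 1) (by convert hi using 2; ring)
    exact Finset.mem_map.2 ⟨i - 1, this, by simp⟩

theorem measure_eq_of_finCyl (hd : 0 < d) {μ ν : Measure (Omega d)} [IsFiniteMeasure μ]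
    [IsFiniteMeasure ν] (h : ∀ F x, μ.real (finCyl F x) = ν.real (finCyl F x)) : μ = ν := by
  have hν : IsProjectiveLimit ν fun I : Finset ℤ => ν.map I.restrict := fun _ => rfl
  refine IsProjectiveLimit.unique (P := fun I : Finset ℤ => ν.map I.restrict) (fun I => ?_) hν
  refine Measure.ext_of_singleton fun g => ?_
  have hpre : I.restrict ⁻¹' ({g} : Set (I → Fin d)) = finCyl I (overwrite I g fun _ : ℤ => (⟨0, hd⟩ : Fin d)) := by
    ext z
    rw [Set.mem_preimage, Set.mem_singleton_iff, funext_iff, Subtype.forall]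
    refine forall₂_congr fun j hj => ?_
    rw [overwrite_of_mem _ _ hj]
    rfl
  rw [Measure.map_apply (I.measurable_restrict) (measurableSet_singleton g),
    Measure.map_apply (I.measurable_restrict) (measurableSet_singleton g), hpre]
  exact (measureReal_eq_measureReal_iff).1 (h _ _)

end Measures

/-- a C*-Gibbs probability for a finite-range potential is
invariant under the shift `τ`. -/
theorem cstarGibbs_shift_invariant (d : ℕ) (hd : 2 ≤ d) (U : Omega d → ℝ)
    (hU : FiniteRange d U) (α : Measure (Omega d)) (hα : IsProbabilityMeasure α)
    (hGibbs : CStarGibbs d U α) :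
    ∀ B : Set (Omega d), MeasurableSet B → α (tau d ⁻¹' B) = α B := by
  obtain ⟨R, hR⟩ := hU.exists_hasRange
  have hd0 : 0 < d := by omega
  have hfam := hGibbs.isGibbsFamily hR
  have hmap : IsProbabilityMeasure (α.map (tau d)) :=
    Measure.isProbabilityMeasure_map measurable_tau.aemeasurable
  have hone : ∀ (μ : Measure (Omega d)) [IsProbabilityMeasure μ] (x : Omega d),
      μ.real (finCyl ∅ x) = 1 := fun μ _ x => by simp [finCyl]
  have hinv : α.map (tau d) = α := measure_eq_of_finCyl hd0 fun F x =>
    le_antisymm (hfam.le hd0 hR hfam.map_tau (hone α) (hone _) F x)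
      (hfam.map_tau.le hd0 hR hfam (hone _) (hone α) F x)
  intro B hB
  rw [← Measure.map_apply measurable_tau hB, hinv]
end
end

section
/- Let U : Ω → ℝ be a potential depending on only finitely many coordinates. Then there exist an integer r ≥ 1, a function K : {1,…,d}^r → ℝ, a function g : Ω → ℝ depending on only finitely many coordinates, and a constant λ ∈ ℝ, such that the potential Ũ = U + g − g ∘ τ − λ satisfies Ũ(x) = K(x₁,…,x_r) for all x ∈ Ω (it depends only on the future coordinates x₁,…,x_r) and Ũ is normalized: ∑_{j=1}^d exp(K(j, x₁,…,x_{r−1})) = 1 for every (x₁,…,x_{r−1}) ∈ {1,…,d}^{r−1}. -/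
open MeasureTheory Filter
open scoped ENNReal

noncomputable section

/-- A nonnegative linear endomorphism of `ℝ^ι` some power of which is strictly positive has a
positive eigenvector with positive eigenvalue (Perron–Frobenius). -/
theorem exists_pos_eigenvector {ι : Type*} [Fintype ι] [Nonempty ι]
    (A : Module.End ℝ (ι → ℝ)) (hA : ∀ v, 0 ≤ v → 0 ≤ A v) (n : ℕ) (hn : n ≠ 0)
    (hpos : ∀ v, 0 ≤ v → v ≠ 0 → ∀ i, 0 < (A ^ n) v i) :
    ∃ (t : ℝ) (v : ι → ℝ), 0 < t ∧ (∀ i, 0 < v i) ∧ A v = t • v := by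
  classical
  have hAc : Continuous A := A.continuous_of_finiteDimensional
  have hsumc : Continuous fun v : ι → ℝ => ∑ i, A v i :=
    continuous_finsetSum _ fun i _ => (continuous_apply i).comp hAc
  obtain ⟨C, hC⟩ := (isCompact_stdSimplex ℝ ι).bddAbove_image hsumc.continuousOn
  have hbound : ∀ (t : ℝ) (v : ι → ℝ), v ∈ stdSimplex ℝ ι → (∀ i, t * v i ≤ A v i) → t ≤ C := by
    intro t v hv h
    calc t = ∑ i, t * v i := by rw [← Finset.mul_sum, hv.2, mul_one]
      _ ≤ ∑ i, A v i := Finset.sum_le_sum fun i _ => h i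
      _ ≤ C := hC ⟨v, hv, rfl⟩
  let S : Set (ℝ × (ι → ℝ)) :=
    (Set.Icc 0 C ×ˢ stdSimplex ℝ ι) ∩ {p | ∀ i, p.1 * p.2 i ≤ A p.2 i}
  have hclosed : IsClosed {p : ℝ × (ι → ℝ) | ∀ i, p.1 * p.2 i ≤ A p.2 i} := by
    rw [Set.ofPred_forall]
    refine isClosed_iInter fun i => isClosed_le ?_ ?_
    · fun_prop
    · exact (continuous_apply i).comp (hAc.comp continuous_snd)
  have hS : IsCompact S := (isCompact_Icc.prod (isCompact_stdSimplex ℝ ι)).inter_right hclosed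
  have hmem : ∀ (t : ℝ) (v : ι → ℝ), 0 ≤ t → v ∈ stdSimplex ℝ ι → (∀ i, t * v i ≤ A v i) →
      (t, v) ∈ S :=
    fun t v ht hv h => ⟨⟨⟨ht, hbound t v hv h⟩, hv⟩, h⟩
  have hne : S.Nonempty := by
    obtain ⟨i⟩ := ‹Nonempty ι›
    have hv := single_mem_stdSimplex ℝ i
    exact ⟨_, hmem 0 _ le_rfl hv fun j => by simpa using hA _ hv.1 j⟩
  obtain ⟨⟨t, v⟩, ⟨⟨⟨ht, -⟩, hv⟩, htv⟩, hmax⟩ := hS.exists_isMaxOn hne continuous_fst.continuousOn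
  simp only [Set.mem_ofPred_eq] at ht hv htv
  have hv0 : v ≠ 0 := by
    rintro rfl
    simpa using hv.2
  have heig : A v = t • v := by
    by_contra hcon
    set w := (A ^ n) v with hw
    have hwpos : ∀ i, 0 < w i := hpos v hv.1 hv0
    have hAw : A w = (A ^ n) (A v) := by
      rw [hw, ← Module.End.mul_apply, ← Module.End.mul_apply, ← pow_succ, ← pow_succ']
    have hgt : ∀ i, t * w i < A w i := by
      intro i
      have h := hpos (A v - t • v) (fun i => by simpa using htv i) (sub_ne_zero.mpr hcon) i
      rw [map_sub, map_smul, ← hAw] at h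
      simpa using h
    set t' := Finset.univ.inf' Finset.univ_nonempty fun i => A w i / w i with ht'
    have htt' : t < t' := by
      rw [ht', Finset.lt_inf'_iff]
      exact fun i _ => (lt_div_iff₀ (hwpos i)).mpr (hgt i)
    have hle : ∀ i, t' * w i ≤ A w i := fun i =>
      (le_div_iff₀ (hwpos i)).mp (Finset.inf'_le _ (Finset.mem_univ i))
    have hs : 0 < ∑ i, w i := Finset.sum_pos (fun i _ => hwpos i) Finset.univ_nonempty
    have hmem' : (t', (∑ i, w i)⁻¹ • w) ∈ S := by
      refine hmem _ _ (ht.trans htt'.le) ⟨fun i => ?_, ?_⟩ fun i => ?_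
      · exact mul_nonneg (inv_nonneg.mpr hs.le) (hwpos i).le
      · simp only [Pi.smul_apply, smul_eq_mul, ← Finset.mul_sum]
        exact inv_mul_cancel₀ hs.ne'
      · rw [map_smul]
        simp only [Pi.smul_apply, smul_eq_mul]
        rw [mul_left_comm]
        exact mul_le_mul_of_nonneg_left (hle i) (inv_nonneg.mpr hs.le)
    exact absurd (hmax hmem') (not_le.mpr htt')
  have hpow : ∀ k : ℕ, (A ^ k) v = t ^ k • v := by
    intro k
    induction k with
    | zero => simp
    | succ k ih => rw [pow_succ, Module.End.mul_apply, heig, map_smul, ih, smul_smul, pow_succ']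
  have hprod : ∀ i, 0 < t ^ n * v i := fun i => by
    simpa [hpow n] using hpos v hv.1 hv0 i
  refine ⟨t, v, ?_, fun i => ?_, heig⟩
  · obtain ⟨i⟩ := ‹Nonempty ι›
    refine ht.lt_of_ne ?_
    rintro rfl
    simpa [hn] using hprod i
  · exact pos_of_mul_pos_right (hprod i) (pow_nonneg ht n)

/-- The word `j w₀ w₁ … w_{m-2}`: put `j` in front of `w` and drop the last letter. -/
def pushFront {d m : ℕ} (j : Fin d) (w : Fin m → Fin d) : Fin m → Fin d :=
  fun i => if i.val = 0 then j else w ⟨i.val - 1, by omega⟩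

/-- The transfer operator of a potential `φ` on words of length `m`. -/
def transferOperator {d m : ℕ} (φ : (Fin m → Fin d) → ℝ) :
    Module.End ℝ ((Fin m → Fin d) → ℝ) where
  toFun f w := ∑ j, Real.exp (φ (pushFront j w)) * f (pushFront j w)
  map_add' f g := by
    ext w
    simp [mul_add, Finset.sum_add_distrib]
  map_smul' c f := by
    ext w
    simp [Finset.mul_sum, mul_left_comm]

theorem transferOperator_apply {d m : ℕ} (φ f : (Fin m → Fin d) → ℝ) (w : Fin m → Fin d) :
    transferOperator φ f w = ∑ j, Real.exp (φ (pushFront j w)) * f (pushFront j w) :=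
  rfl

theorem transferOperator_nonneg {d m : ℕ} (φ f : (Fin m → Fin d) → ℝ) (hf : 0 ≤ f) :
    0 ≤ transferOperator φ f :=
  fun w => show 0 ≤ ∑ j, Real.exp (φ (pushFront j w)) * f (pushFront j w) from
    Finset.sum_nonneg fun _ _ => mul_nonneg (Real.exp_pos _).le (hf _)

theorem transferOperator_pow_nonneg {d m : ℕ} (φ f : (Fin m → Fin d) → ℝ) (hf : 0 ≤ f) (k : ℕ) :
    0 ≤ (transferOperator φ ^ k) f := by
  induction k with
  | zero => simpa using hf
  | succ k ih =>
    rw [pow_succ', Module.End.mul_apply]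
    exact transferOperator_nonneg φ _ ih

theorem transferOperator_pow_pos_of_shift {d m : ℕ} (φ f : (Fin m → Fin d) → ℝ) (hf : 0 ≤ f)
    (u : Fin m → Fin d) (hu : 0 < f u) (k : ℕ) (hk : k ≤ m) (w : Fin m → Fin d)
    (hw : ∀ (i : ℕ) (hi : i + k < m), w ⟨i, by omega⟩ = u ⟨i + k, hi⟩) :
    0 < (transferOperator φ ^ k) f w := by
  induction k generalizing w with
  | zero =>
    have : w = u := funext fun i => hw i i.isLt
    simpa [this] using hu
  | succ k ih =>
    rw [pow_succ', Module.End.mul_apply, transferOperator_apply]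
    refine Finset.sum_pos' (fun j _ => mul_nonneg (Real.exp_pos _).le
      (transferOperator_pow_nonneg φ f hf k _)) ⟨u ⟨k, hk⟩, Finset.mem_univ _, ?_⟩
    refine mul_pos (Real.exp_pos _) (ih (by omega) _ fun i hi => ?_)
    rcases i with _ | i
    · simp [pushFront]
    · simpa [pushFront, add_assoc, add_comm 1 k] using hw i (by omega)

theorem transferOperator_pow_pos {d m : ℕ} (φ f : (Fin m → Fin d) → ℝ) (hf : 0 ≤ f)
    (hf0 : f ≠ 0) (w : Fin m → Fin d) : 0 < (transferOperator φ ^ m) f w := by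
  obtain ⟨u, hu⟩ := Function.ne_iff.mp hf0
  exact transferOperator_pow_pos_of_shift φ f hf u ((hf u).lt_of_ne' hu) m le_rfl w
    fun i hi => by omega

theorem FiniteRange.comp_tauZ {d : ℕ} {U : Omega d → ℝ} (hU : FiniteRange d U) (k : ℤ) :
    FiniteRange d fun x => U (tauZ d k x) := by
  obtain ⟨s, hs⟩ := hU
  exact ⟨s.image (· + k), fun x y h => hs _ _ fun j hj => h _ (Finset.mem_image_of_mem _ hj)⟩

theorem FiniteRange.map₂ {d : ℕ} {U V : Omega d → ℝ} (hU : FiniteRange d U)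
    (hV : FiniteRange d V) (F : ℝ → ℝ → ℝ) : FiniteRange d fun x => F (U x) (V x) := by
  obtain ⟨s, hs⟩ := hU
  obtain ⟨t, ht⟩ := hV
  refine ⟨s ∪ t, fun x y h => ?_⟩
  simp only [hs x y fun j hj => h j (Finset.mem_union_left t hj),
    ht x y fun j hj => h j (Finset.mem_union_right s hj)]

theorem FiniteRange.birkhoff {d : ℕ} {U : Omega d → ℝ} (hU : FiniteRange d U) (n : ℕ) :
    FiniteRange d (birkhoff d U n) := by
  induction n with
  | zero => exact ⟨∅, fun x y _ => by simp [_root_.birkhoff]⟩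
  | succ n ih =>
    convert ih.map₂ (hU.comp_tauZ n) (· + ·) using 2 with x
    simp [_root_.birkhoff, Finset.sum_range_succ]

theorem birkhoff_tau_sub_birkhoff (d : ℕ) (U : Omega d → ℝ) (n : ℕ) (x : Omega d) :
    birkhoff d U n (tau d x) - birkhoff d U n x = U (tauZ d n x) - U x := by
  have hshift : ∀ k : ℕ, tauZ d (k : ℤ) (tau d x) = tauZ d ((k + 1 : ℕ) : ℤ) x := fun k => by
    ext j
    simp [tauZ, tau, add_assoc]
  have hzero : tauZ d ((0 : ℕ) : ℤ) x = x := by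
    ext j
    simp [tauZ]
  simp only [birkhoff, hshift, ← Finset.sum_sub_distrib]
  rw [Finset.sum_range_sub fun k : ℕ => U (tauZ d (k : ℤ) x), hzero]

/-- The word `x₁ … x_m`. -/
def futureWord {d : ℕ} (m : ℕ) (x : Omega d) : Fin m → Fin d := fun i => x ((i : ℕ) + 1)

theorem futureWord_prepend {d m : ℕ} (j : Fin d) (x : Omega d) :
    futureWord m (prepend d j x) = pushFront j (futureWord m x) := by
  funext i
  rcases i with ⟨_ | i, hi⟩
  · simp [futureWord, prepend, pushFront]
  · have h : (i : ℤ) + 1 ≠ 0 := by omega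
    simp [futureWord, prepend, pushFront, h]

theorem futureWord_tau_prepend {d m : ℕ} (j : Fin d) (x : Omega d) :
    futureWord m (tau d (prepend d j x)) = futureWord m x := by
  funext i
  have h : ((i : ℕ) : ℤ) + 1 ≠ 0 := by omega
  simp [futureWord, prepend, tau, h]

theorem finiteRange_comp_futureWord {d m : ℕ} (f : (Fin m → Fin d) → ℝ) :
    FiniteRange d fun x => f (futureWord m x) :=
  ⟨Finset.univ.image fun i : Fin m => ((i : ℕ) : ℤ) + 1, fun _ _ h => congrArg f <|
    funext fun i => h _ (Finset.mem_image_of_mem _ (Finset.mem_univ i))⟩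

/-- Shifting a finite-range potential far enough makes it depend on future coordinates only. -/
theorem FiniteRange.exists_future {d : ℕ} {U : Omega d → ℝ} (hU : FiniteRange d U) :
    ∃ (n m : ℕ) (φ : (Fin m → Fin d) → ℝ), m ≠ 0 ∧ ∀ x, U (tauZ d n x) = φ (futureWord m x) := by
  obtain ⟨s, hs⟩ := hU
  let M := s.sup Int.natAbs
  have hfac : Function.FactorsThrough (fun x => U (tauZ d ((M + 1 : ℕ) : ℤ) x))
      (futureWord (2 * M + 1)) := by
    refine fun x y h => hs _ _ fun j hj => ?_
    have hjM : j.natAbs ≤ M := Finset.le_sup (f := Int.natAbs) hj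
    have := congrFun h ⟨(j + M).toNat, by omega⟩
    simp only [futureWord] at this
    rw [Int.toNat_of_nonneg (by omega)] at this
    simpa [tauZ, add_assoc] using this
  obtain ⟨φ, hφ⟩ := (Function.factorsThrough_iff _).mp hfac
  exact ⟨M + 1, 2 * M + 1, φ, by omega, congrFun hφ⟩

/-- a finite-range potential is cohomologous (via a finite-range
`g` and a constant `λ`) to a normalized potential `Ũ = U + g - g∘τ - λ`
depending only on the future coordinates `x₁,…,x_r`. -/
theorem finite_range_normalization (d : ℕ) (hd : 2 ≤ d) (U : Omega d → ℝ)
    (hU : FiniteRange d U) :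
    ∃ (r : ℕ) (K : (Fin r → Fin d) → ℝ) (g : Omega d → ℝ) (lam : ℝ),
      1 ≤ r ∧ FiniteRange d g ∧
      (∀ x : Omega d,
        U x + g x - g (tau d x) - lam = K (fun i => x (((i : ℕ) : ℤ) + 1))) ∧
      Normalized d (fun x => U x + g x - g (tau d x) - lam) := by
  have : Nonempty (Fin d) := ⟨⟨0, by omega⟩⟩
  obtain ⟨n, m, φ, hm, hφ⟩ := hU.exists_future
  obtain ⟨t, v, ht, hv, heig⟩ := exists_pos_eigenvector (transferOperator φ)
    (transferOperator_nonneg φ) m hm (transferOperator_pow_pos φ)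
  let g : Omega d → ℝ := fun x => Real.log (v (futureWord m x)) - birkhoff d U n x
  have hcob : ∀ x, U x + g x - g (tau d x) - Real.log t =
      φ (futureWord m x) + Real.log (v (futureWord m x)) -
        Real.log (v (futureWord m (tau d x))) - Real.log t := by
    intro x
    have h := birkhoff_tau_sub_birkhoff d U n x
    rw [hφ] at h
    simp only [g]
    linarith
  refine ⟨m + 1, fun y => φ (fun i => y i.castSucc) + Real.log (v fun i => y i.castSucc) -
      Real.log (v fun i => y i.succ) - Real.log t, g, Real.log t, by omega,
    (finiteRange_comp_futureWord fun w => Real.log (v w)).map₂ (hU.birkhoff n) (· - ·),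
    fun x => ?_, fun x => ?_⟩
  · have hword : futureWord m (tau d x) = fun i : Fin m => x (((i.succ : ℕ) : ℤ) + 1) := by
      funext i
      simp [futureWord, tau]
    rw [hcob, hword]
    rfl
  · have hsum := congrFun heig (futureWord m x)
    rw [transferOperator_apply, Pi.smul_apply, smul_eq_mul] at hsum
    simp only [hcob, futureWord_prepend, futureWord_tau_prepend, Real.exp_sub, Real.exp_add,
      Real.exp_log ht, Real.exp_log (hv _), ← Finset.sum_div]
    rw [hsum, mul_div_assoc, div_self (hv _).ne', mul_one, div_self ht.ne']
end
end
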